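/- Let A_1(N), …, A_k(N) be a unitarily invariant ensemble with limit law τ. Then for every noncommutative polynomial q in k variables and all fixed indices a, b (independent of N), lim_{N→∞} E [q(A_1(N), …, A_k(N))]_{a,b} = δ_{a,b} τ(q). -/

import Mathlib

open Matrix MeasureTheory Filter

noncomputable instance {N : ℕ} : MeasurableSpace (Matrix.unitaryGroup (Fin N) ℂ) :=
  borel _

/-- The ℓ²→ℓ² operator norm of a complex matrix. -/
noncomputable def opNorm {N : ℕ} (X : Matrix (Fin N) (Fin N) ℂ) : ℝ :=
  ‖Matrix.toEuclideanCLM (𝕜 := ℂ) X‖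

/-- Evaluation of a noncommutative polynomial `q` at the matrices `UΛ₁U*, …, UΛ_kU*`. -/
noncomputable def evalAt {k N : ℕ} (Λ : Fin k → Matrix (Fin N) (Fin N) ℂ)
    (U : Matrix.unitaryGroup (Fin N) ℂ) (q : FreeAlgebra ℂ (Fin k)) :
    Matrix (Fin N) (Fin N) ℂ :=
  FreeAlgebra.lift ℂ
    (fun j => (U : Matrix (Fin N) (Fin N) ℂ) * Λ j * (U : Matrix (Fin N) (Fin N) ℂ)ᴴ) q

/-- The `(a,b)` entry of an `N×N` matrix for fixed natural-number indices `a, b`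
(defined to be `0` if `a ≥ N` or `b ≥ N`). -/
def entryPad {N : ℕ} (M : Matrix (Fin N) (Fin N) ℂ) (a b : ℕ) : ℂ :=
  if ha : a < N then (if hb : b < N then M ⟨a, ha⟩ ⟨b, hb⟩ else 0) else 0



instance borelSpaceU {N : ℕ} : BorelSpace (Matrix.unitaryGroup (Fin N) ℂ) := ⟨rfl⟩

lemma evalAt_eq {k N : ℕ} (Λ : Fin k → Matrix (Fin N) (Fin N) ℂ)
    (U : Matrix.unitaryGroup (Fin N) ℂ) (q : FreeAlgebra ℂ (Fin k)) :
    evalAt Λ U q = (U : Matrix (Fin N) (Fin N) ℂ) * FreeAlgebra.lift ℂ Λ q *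
      (U : Matrix (Fin N) (Fin N) ℂ)ᴴ := by
  have h1 : (U : Matrix (Fin N) (Fin N) ℂ)ᴴ * (U : Matrix (Fin N) (Fin N) ℂ) = 1 :=
    Matrix.mem_unitaryGroup_iff'.1 U.2
  have h2 : (U : Matrix (Fin N) (Fin N) ℂ) * (U : Matrix (Fin N) (Fin N) ℂ)ᴴ = 1 :=
    Matrix.mem_unitaryGroup_iff.1 U.2
  unfold evalAt
  induction q using FreeAlgebra.induction with
  | grade0 r =>
    rw [AlgHom.commutes, AlgHom.commutes]
    simp only [Algebra.algebraMap_eq_smul_one, Matrix.mul_smul, Matrix.smul_mul,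
      Matrix.mul_one, h2]
  | grade1 x => simp
  | mul p q hp hq =>
    rw [map_mul, map_mul, hp, hq]
    simp only [Matrix.mul_assoc]
    rw [← Matrix.mul_assoc _ (U : Matrix (Fin N) (Fin N) ℂ) _, h1, Matrix.one_mul]
  | add p q hp hq =>
    rw [map_add, map_add, hp, hq, Matrix.mul_add, Matrix.add_mul]

lemma evalAt_mul {k N : ℕ} (Λ : Fin k → Matrix (Fin N) (Fin N) ℂ)
    (V U : Matrix.unitaryGroup (Fin N) ℂ) (q : FreeAlgebra ℂ (Fin k)) :
    evalAt Λ (V * U) q = (V : Matrix (Fin N) (Fin N) ℂ) * evalAt Λ U q *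
      (V : Matrix (Fin N) (Fin N) ℂ)ᴴ := by
  simp [evalAt_eq, Matrix.mul_assoc, Matrix.conjTranspose_mul]

lemma integrable_entry {k N : ℕ} (Λ : Fin k → Matrix (Fin N) (Fin N) ℂ)
    (μ : Measure (Matrix.unitaryGroup (Fin N) ℂ)) [IsProbabilityMeasure μ]
    (q : FreeAlgebra ℂ (Fin k)) (i j : Fin N) :
    Integrable (fun U => evalAt Λ U q i j) μ := by
  simp only [evalAt_eq]
  set B := FreeAlgebra.lift ℂ Λ q
  have hc : Continuous (fun U : Matrix.unitaryGroup (Fin N) ℂ =>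
      ((U : Matrix (Fin N) (Fin N) ℂ) * B * (U : Matrix (Fin N) (Fin N) ℂ)ᴴ) i j) := by
    have : Continuous (fun U : Matrix.unitaryGroup (Fin N) ℂ =>
      ((U : Matrix (Fin N) (Fin N) ℂ) * B * (U : Matrix (Fin N) (Fin N) ℂ)ᴴ)) := by
      have := continuous_subtype_val (p := fun x => x ∈ Matrix.unitaryGroup (Fin N) ℂ)
      exact (this.matrix_mul continuous_const).matrix_mul this.matrix_conjTranspose
    exact this.matrix_elem i j
  refine Integrable.of_bound hc.aestronglyMeasurable (∑ l, ∑ m, ‖B m l‖) (ae_of_all _ ?_)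
  intro U
  have hU : ∀ x y, ‖(U : Matrix (Fin N) (Fin N) ℂ) x y‖ ≤ 1 :=
    fun x y => entry_norm_bound_of_unitary U.2 x y
  rw [Matrix.mul_apply]
  refine (norm_sum_le _ _).trans (Finset.sum_le_sum fun l _ => ?_)
  rw [norm_mul, Matrix.conjTranspose_apply, norm_star, Matrix.mul_apply]
  refine (mul_le_of_le_one_right (norm_nonneg _) (hU _ _)).trans ?_
  refine (norm_sum_le _ _).trans (Finset.sum_le_sum fun m _ => ?_)
  rw [norm_mul]
  exact mul_le_of_le_one_left (norm_nonneg _) (hU _ _)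

lemma integral_unitary_conj {k N : ℕ} (Λ : Fin k → Matrix (Fin N) (Fin N) ℂ)
    (μ : Measure (Matrix.unitaryGroup (Fin N) ℂ)) [μ.IsMulLeftInvariant]
    (q : FreeAlgebra ℂ (Fin k)) (i j : Fin N) (V : Matrix.unitaryGroup (Fin N) ℂ) :
    ∫ U, ((V : Matrix (Fin N) (Fin N) ℂ) * evalAt Λ U q *
      (V : Matrix (Fin N) (Fin N) ℂ)ᴴ) i j ∂μ = ∫ U, evalAt Λ U q i j ∂μ := by
  rw [← integral_mul_left_eq_self (μ := μ) (fun U => evalAt Λ U q i j) V]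
  simp only [evalAt_mul]

lemma integral_offdiag {k N : ℕ} (Λ : Fin k → Matrix (Fin N) (Fin N) ℂ)
    (μ : Measure (Matrix.unitaryGroup (Fin N) ℂ)) [μ.IsMulLeftInvariant]
    (q : FreeAlgebra ℂ (Fin k)) (i j : Fin N) (hij : i ≠ j) :
    ∫ U, evalAt Λ U q i j ∂μ = 0 := by
  let d : Fin N → ℂ := fun x => if x = i then -1 else 1
  have hV : Matrix.diagonal d ∈ Matrix.unitaryGroup (Fin N) ℂ := by
    rw [Matrix.mem_unitaryGroup_iff, Matrix.star_eq_conjTranspose,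
      Matrix.diagonal_conjTranspose, Matrix.diagonal_mul_diagonal, ← Matrix.diagonal_one]
    congr 1
    funext x
    by_cases h : x = i <;> simp [d, h]
  have h := integral_unitary_conj Λ μ q i j ⟨_, hV⟩
  simp only [Matrix.diagonal_conjTranspose, Matrix.mul_diagonal, Matrix.diagonal_mul] at h
  have h3 : ∀ X : ℂ, d i * X * star d j = -X := by
    intro X
    simp [d, hij.symm]
  simp only [h3, integral_neg] at h
  linear_combination (-1/2 : ℂ) * h

lemma integral_diag {k N : ℕ} (Λ : Fin k → Matrix (Fin N) (Fin N) ℂ)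
    (μ : Measure (Matrix.unitaryGroup (Fin N) ℂ)) [μ.IsMulLeftInvariant]
    (q : FreeAlgebra ℂ (Fin k)) (i j : Fin N) :
    ∫ U, evalAt Λ U q j j ∂μ = ∫ U, evalAt Λ U q i i ∂μ := by
  let P : Matrix (Fin N) (Fin N) ℂ := fun x y => if y = Equiv.swap i j x then 1 else 0
  have hP : ∀ (X : Matrix (Fin N) (Fin N) ℂ) x y,
      (P * X * Pᴴ) x y = X (Equiv.swap i j x) (Equiv.swap i j y) := by
    intro X x y
    have hP0 : ∀ x y, P x y = if y = Equiv.swap i j x then 1 else 0 := fun _ _ => rfl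
    simp [Matrix.mul_apply, Matrix.conjTranspose_apply, hP0, apply_ite]
  have hV : P ∈ Matrix.unitaryGroup (Fin N) ℂ := by
    rw [Matrix.mem_unitaryGroup_iff, Matrix.star_eq_conjTranspose]
    ext x y
    have := hP 1 x y
    rw [Matrix.mul_one] at this
    rw [this]
    simp [Matrix.one_apply]
  have h := integral_unitary_conj Λ μ q i i ⟨_, hV⟩
  simpa only [hP, Equiv.swap_apply_left] using h

/-- For a unitarily invariant ensemble with limit law `τ`, the expected matrix entries
of any noncommutative polynomial in the ensemble converge:
`lim_N E [q(A₁(N),…,A_k(N))]_{a,b} = δ_{a,b} τ(q)` for fixed indices `a, b`. -/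
theorem unitarilyInvariant_expected_entry_limit
    (k : ℕ)
    (Λ : (N : ℕ) → Fin k → Matrix (Fin N) (Fin N) ℂ)
    (hΛsa : ∀ N j, (Λ N j)ᴴ = Λ N j)
    (hΛbdd : ∃ C : ℝ, ∀ N j, opNorm (Λ N j) ≤ C)
    (μ : (N : ℕ) → Measure (Matrix.unitaryGroup (Fin N) ℂ))
    (hprob : ∀ N, IsProbabilityMeasure (μ N))
    (hinv : ∀ N, (μ N).IsMulLeftInvariant)
    (τ : FreeAlgebra ℂ (Fin k) → ℂ)
    (hτ : ∀ q : FreeAlgebra ℂ (Fin k),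
      Tendsto (fun N => (∫ U, (evalAt (Λ N) U q).trace ∂(μ N)) / (N : ℂ))
        atTop (nhds (τ q)))
    (q : FreeAlgebra ℂ (Fin k)) (a b : ℕ) :
    Tendsto (fun N => ∫ U, entryPad (evalAt (Λ N) U q) a b ∂(μ N))
      atTop (nhds (if a = b then τ q else 0)) := by
  have hdiag : ∀ N, a < N → ∀ (ha : a < N), ∫ U, evalAt (Λ N) U q ⟨a, ha⟩ ⟨a, ha⟩ ∂(μ N)
      = (∫ U, (evalAt (Λ N) U q).trace ∂(μ N)) / (N : ℂ) := by
    intro N _ ha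
    haveI := hprob N
    haveI := hinv N
    have hN : (N : ℂ) ≠ 0 := by
      have : N ≠ 0 := by omega
      exact_mod_cast this
    rw [eq_div_iff hN]
    simp only [Matrix.trace, Matrix.diag_apply]
    rw [integral_finsetSum _ (fun i _ => integrable_entry (Λ N) (μ N) q i i)]
    rw [Finset.sum_congr rfl (fun i _ => integral_diag (Λ N) (μ N) q ⟨a, ha⟩ i)]
    simp [mul_comm]
  by_cases hab : a = b
  · subst hab
    rw [if_pos rfl]
    refine (hτ q).congr' ?_
    filter_upwards [eventually_gt_atTop a] with N hN
    simp only [entryPad, dif_pos hN]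
    exact (hdiag N hN hN).symm
  · rw [if_neg hab]
    refine tendsto_const_nhds.congr' ?_
    filter_upwards [eventually_gt_atTop a, eventually_gt_atTop b] with N ha hb
    haveI := hinv N
    simp only [entryPad, dif_pos ha, dif_pos hb]
    refine (integral_offdiag (Λ N) (μ N) q _ _ ?_).symm
    simpa using hab
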